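/- (Lemma 4.5) Asymptotic directions are invariant under the tangent map of the inversion if and only if η vanishes: let (a,b) ≠ (0,0) represent an asymptotic tangent vector of x at a point (u₀,v₀), i.e. ea² + 2fab + gb² = 0 at (u₀,v₀). Then a y_u + b y_v is asymptotic for y, i.e. ẽa² + 2f̃ab + g̃b² = 0 at (u₀,v₀), if and only if η(u₀,v₀) = 0. -/

import Mathlib

noncomputable section
open scoped RealInnerProductSpace

/-- ℝ³ as Euclidean 3-space. -/
abbrev E3 : Type := EuclideanSpace ℝ (Fin 3)

/-- The cross product on ℝ³. -/
def cross (a b : E3) : E3 :=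
  (WithLp.equiv 2 (Fin 3 → ℝ)).symm
    ![a 1 * b 2 - a 2 * b 1, a 2 * b 0 - a 0 * b 2, a 0 * b 1 - a 1 * b 0]

/-- The inversion of ℝ³ with center `c` and radius `r`. -/
def inv3 (c : E3) (r : ℝ) (p : E3) : E3 :=
  c + (r ^ 2 / ‖p - c‖ ^ 2) • (p - c)

/-- Partial derivative in the first variable. -/
def pu {E : Type*} [NormedAddCommGroup E] [NormedSpace ℝ E]
    (x : ℝ → ℝ → E) (u v : ℝ) : E :=
  deriv (fun t => x t v) u

/-- Partial derivative in the second variable. -/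
def pv {E : Type*} [NormedAddCommGroup E] [NormedSpace ℝ E]
    (x : ℝ → ℝ → E) (u v : ℝ) : E :=
  deriv (fun t => x u t) v

/-- The unit normal of a patch. -/
def unormal (x : ℝ → ℝ → E3) (u v : ℝ) : E3 :=
  ‖cross (pu x u v) (pv x u v)‖⁻¹ • cross (pu x u v) (pv x u v)

/-- The conformal factor λ of the inversion along the patch. -/
def lam (c : E3) (r : ℝ) (x : ℝ → ℝ → E3) (u v : ℝ) : ℝ :=
  r ^ 2 / ‖x u v - c‖ ^ 2

/-- The support-type function η = ⟨U_x, x − c⟩. -/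
def eta (c : E3) (x : ℝ → ℝ → E3) (u v : ℝ) : ℝ :=
  ⟪unormal x u v, x u v - c⟫

/-- First fundamental form coefficient E. -/
def FFE (x : ℝ → ℝ → E3) (u v : ℝ) : ℝ := ⟪pu x u v, pu x u v⟫
/-- First fundamental form coefficient F. -/
def FFF (x : ℝ → ℝ → E3) (u v : ℝ) : ℝ := ⟪pu x u v, pv x u v⟫
/-- First fundamental form coefficient G. -/
def FFG (x : ℝ → ℝ → E3) (u v : ℝ) : ℝ := ⟪pv x u v, pv x u v⟫
/-- Second fundamental form coefficient e. -/
def SFe (x : ℝ → ℝ → E3) (u v : ℝ) : ℝ := ⟪pu (pu x) u v, unormal x u v⟫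
/-- Second fundamental form coefficient f. -/
def SFf (x : ℝ → ℝ → E3) (u v : ℝ) : ℝ := ⟪pv (pu x) u v, unormal x u v⟫
/-- Second fundamental form coefficient g. -/
def SFg (x : ℝ → ℝ → E3) (u v : ℝ) : ℝ := ⟪pv (pv x) u v, unormal x u v⟫
/-- Third fundamental form coefficient P. -/
def TFP (x : ℝ → ℝ → E3) (u v : ℝ) : ℝ := ⟪pu (unormal x) u v, pu (unormal x) u v⟫
/-- Third fundamental form coefficient Q. -/
def TFQ (x : ℝ → ℝ → E3) (u v : ℝ) : ℝ := ⟪pu (unormal x) u v, pv (unormal x) u v⟫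
/-- Third fundamental form coefficient R. -/
def TFR (x : ℝ → ℝ → E3) (u v : ℝ) : ℝ := ⟪pv (unormal x) u v, pv (unormal x) u v⟫

/-- Christoffel symbol Γ¹₁₁. -/
def Ch111 (x : ℝ → ℝ → E3) (u v : ℝ) : ℝ :=
  (FFG x u v * pu (FFE x) u v - 2 * FFF x u v * pu (FFF x) u v + FFF x u v * pv (FFE x) u v) /
    (2 * (FFE x u v * FFG x u v - FFF x u v ^ 2))
/-- Christoffel symbol Γ²₁₁. -/
def Ch211 (x : ℝ → ℝ → E3) (u v : ℝ) : ℝ :=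
  (2 * FFE x u v * pu (FFF x) u v - FFE x u v * pv (FFE x) u v - FFF x u v * pu (FFE x) u v) /
    (2 * (FFE x u v * FFG x u v - FFF x u v ^ 2))
/-- Christoffel symbol Γ¹₁₂. -/
def Ch112 (x : ℝ → ℝ → E3) (u v : ℝ) : ℝ :=
  (FFG x u v * pv (FFE x) u v - FFF x u v * pu (FFG x) u v) /
    (2 * (FFE x u v * FFG x u v - FFF x u v ^ 2))
/-- Christoffel symbol Γ²₁₂. -/
def Ch212 (x : ℝ → ℝ → E3) (u v : ℝ) : ℝ :=
  (FFE x u v * pu (FFG x) u v - FFF x u v * pv (FFE x) u v) /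
    (2 * (FFE x u v * FFG x u v - FFF x u v ^ 2))
/-- Christoffel symbol Γ¹₂₂. -/
def Ch122 (x : ℝ → ℝ → E3) (u v : ℝ) : ℝ :=
  (2 * FFG x u v * pv (FFF x) u v - FFG x u v * pu (FFG x) u v - FFF x u v * pv (FFG x) u v) /
    (2 * (FFE x u v * FFG x u v - FFF x u v ^ 2))
/-- Christoffel symbol Γ²₂₂. -/
def Ch222 (x : ℝ → ℝ → E3) (u v : ℝ) : ℝ :=
  (FFE x u v * pv (FFG x) u v - 2 * FFF x u v * pv (FFF x) u v + FFF x u v * pu (FFG x) u v) /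
    (2 * (FFE x u v * FFG x u v - FFF x u v ^ 2))

/-- The tangent map of the inversion at `p`. -/
def phiStar (c : E3) (r : ℝ) (p : E3) (w : E3) : E3 :=
  (r ^ 2 / ‖p - c‖ ^ 2) • w - (2 * r ^ 2 * ⟪p - c, w⟫ / ‖p - c‖ ^ 4) • (p - c)

theorem inner_eq_coords (a b : E3) : ⟪a, b⟫ = a 0 * b 0 + a 1 * b 1 + a 2 * b 2 := by
  simp [PiLp.inner_apply, Fin.sum_univ_three, mul_comm]

theorem inner_self_cross (a b : E3) : ⟪a, cross a b⟫ = 0 := by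
  simp only [inner_eq_coords, cross, WithLp.equiv_symm_apply]
  simp
  ring

theorem inner_cross_self (a b : E3) : ⟪b, cross a b⟫ = 0 := by
  simp only [inner_eq_coords, cross, WithLp.equiv_symm_apply]
  simp
  ring

/-- The normal of the image plane under the tangent map of the inversion. -/
theorem cross_phiStar (c : E3) (r : ℝ) (p U V : E3) (hp : p ≠ c) :
    cross (phiStar c r p U) (phiStar c r p V) =
      (-(r ^ 2 / ‖p - c‖ ^ 2) ^ 2) •
        (cross U V - (2 * ⟪p - c, cross U V⟫ / ‖p - c‖ ^ 2) • (p - c)) := by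
  have hz : ‖p - c‖ ^ 2 ≠ 0 := pow_ne_zero 2 (norm_ne_zero_iff.2 (sub_ne_zero.2 hp))
  unfold phiStar
  rw [show ‖p - c‖ ^ 4 = (‖p - c‖ ^ 2) ^ 2 by ring]
  generalize p - c = z at *
  obtain ⟨s, hs⟩ : ∃ s, s = ‖z‖ ^ 2 := ⟨_, rfl⟩
  rw [← hs] at hz ⊢
  rw [← real_inner_self_eq_norm_sq, inner_eq_coords] at hs
  ext i
  fin_cases i <;> simp [inner_eq_coords, cross] <;> field_simp <;> rw [hs] <;> ring

theorem norm_sq_cross_phiStar (c : E3) (r : ℝ) (p U V : E3) (hp : p ≠ c) :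
    ‖cross (phiStar c r p U) (phiStar c r p V)‖ ^ 2 =
      (r ^ 2 / ‖p - c‖ ^ 2) ^ 4 * ‖cross U V‖ ^ 2 := by
  have hz : ‖p - c‖ ^ 2 ≠ 0 := pow_ne_zero 2 (norm_ne_zero_iff.2 (sub_ne_zero.2 hp))
  rw [cross_phiStar c r p U V hp]
  generalize p - c = z at *
  rw [norm_smul, mul_pow, norm_sub_sq_real, norm_smul, mul_pow, inner_smul_right, real_inner_comm, Real.norm_eq_abs, Real.norm_eq_abs, sq_abs, sq_abs]
  field_simp
  ring

/-- The derivative of `phiStar c r (x t) (X t)` along curves whose derivatives are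
`w` and `W` respectively. -/
def phiStarDeriv (c : E3) (r : ℝ) (p w X W : E3) : E3 :=
  phiStar c r p W - (2 * r ^ 2 * ⟪p - c, w⟫ / ‖p - c‖ ^ 4) • X
    - (2 * r ^ 2 * ⟪p - c, X⟫ / ‖p - c‖ ^ 4) • w
    + (8 * r ^ 2 * ⟪p - c, w⟫ * ⟪p - c, X⟫ / ‖p - c‖ ^ 6
        - 2 * r ^ 2 * ⟪w, X⟫ / ‖p - c‖ ^ 4) • (p - c)

theorem inner_phiStarDeriv (c : E3) (r : ℝ) (p w X W N : E3) (hp : p ≠ c)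
    (hw : ⟪w, N⟫ = 0) (hX : ⟪X, N⟫ = 0) :
    ⟪phiStarDeriv c r p w X W, N - (2 * ⟪p - c, N⟫ / ‖p - c‖ ^ 2) • (p - c)⟫ =
      r ^ 2 / ‖p - c‖ ^ 2 * ⟪W, N⟫ + 2 * r ^ 2 * ⟪p - c, N⟫ / ‖p - c‖ ^ 4 * ⟪w, X⟫ := by
  have hz : ‖p - c‖ ≠ 0 := norm_ne_zero_iff.2 (sub_ne_zero.2 hp)
  unfold phiStarDeriv phiStar
  generalize p - c = z at *
  simp only [inner_add_left, inner_sub_left, inner_smul_left,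
    inner_smul_right, hw, hX, real_inner_comm z w,
    inner_sub_right, real_inner_self_eq_norm_sq, conj_trivial, real_inner_comm z X,
    real_inner_comm z W]
  field_simp
  ring

theorem hasDerivAt_norm_sub_sq {x : ℝ → E3} {w : E3} {t : ℝ} (c : E3) (hx : HasDerivAt x w t) :
    HasDerivAt (fun s => ‖x s - c‖ ^ 2) (2 * ⟪x t - c, w⟫) t :=
  (hx.sub_const c).norm_sq

theorem hasDerivAt_inv3 {x : ℝ → E3} {w : E3} {t : ℝ} (c : E3) (r : ℝ)
    (hx : HasDerivAt x w t) (hc : x t ≠ c) :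
    HasDerivAt (fun s => inv3 c r (x s)) (phiStar c r (x t) w) t := by
  have hz : ‖x t - c‖ ≠ 0 := norm_ne_zero_iff.2 (sub_ne_zero.2 hc)
  have h := (((hasDerivAt_const t (r ^ 2)).fun_div (hasDerivAt_norm_sub_sq c hx)
    (pow_ne_zero 2 hz)).smul (hx.sub_const c)).const_add c
  refine h.congr_deriv ?_
  unfold phiStar
  match_scalars <;> field_simp <;> ring

theorem hasDerivAt_phiStar {x X : ℝ → E3} {w W : E3} {t : ℝ} (c : E3) (r : ℝ)
    (hx : HasDerivAt x w t) (hX : HasDerivAt X W t) (hc : x t ≠ c) :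
    HasDerivAt (fun s => phiStar c r (x s) (X s)) (phiStarDeriv c r (x t) w (X t) W) t := by
  have hz : ‖x t - c‖ ≠ 0 := norm_ne_zero_iff.2 (sub_ne_zero.2 hc)
  have hs := hasDerivAt_norm_sub_sq c hx
  have h1 := ((hasDerivAt_const t (r ^ 2)).fun_div hs (pow_ne_zero 2 hz)).smul hX
  have h2 := ((((hx.sub_const c).inner ℝ hX).const_mul (2 * r ^ 2)).fun_div (hs.fun_pow 2)
    (pow_ne_zero 2 (pow_ne_zero 2 hz))).smul (hx.sub_const c)
  have h := h1.sub h2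
  have hfun : (fun s => phiStar c r (x s) (X s)) =
      fun s => (r ^ 2 / ‖x s - c‖ ^ 2) • X s
        - (2 * r ^ 2 * ⟪x s - c, X s⟫ / (‖x s - c‖ ^ 2) ^ 2) • (x s - c) := by
    funext s
    simp only [phiStar, ← pow_mul]
  rw [hfun]
  refine h.congr_deriv ?_
  unfold phiStarDeriv phiStar
  match_scalars <;> field_simp <;> ring

section Partials

variable {E : Type*} [NormedAddCommGroup E] [NormedSpace ℝ E] {x : ℝ → ℝ → E}

theorem hasDerivAt_slice_left (hx : Differentiable ℝ fun p : ℝ × ℝ => x p.1 p.2) (u v : ℝ) :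
    HasDerivAt (fun t => x t v) (pu x u v) u :=
  (hx.comp (by fun_prop : Differentiable ℝ fun t : ℝ => (t, v)) u).hasDerivAt

theorem hasDerivAt_slice_right (hx : Differentiable ℝ fun p : ℝ × ℝ => x p.1 p.2) (u v : ℝ) :
    HasDerivAt (fun t => x u t) (pv x u v) v :=
  (hx.comp (by fun_prop : Differentiable ℝ fun t : ℝ => (u, t)) v).hasDerivAt

theorem differentiable_pu (hx : ContDiff ℝ 2 fun p : ℝ × ℝ => x p.1 p.2) :
    Differentiable ℝ fun p : ℝ × ℝ => pu x p.1 p.2 := by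
  have h : (fun p : ℝ × ℝ => pu x p.1 p.2) =
      fun p => fderiv ℝ (fun p : ℝ × ℝ => x p.1 p.2) p (1, 0) := by
    funext p
    exact ((hx.differentiable two_ne_zero p).hasFDerivAt.comp_hasDerivAt p.1
      ((hasDerivAt_id p.1).prodMk (hasDerivAt_const p.1 p.2))).deriv
  rw [h]
  exact ((hx.fderiv_right (m := 1) (by norm_num)).differentiable one_ne_zero).clm_apply
    (differentiable_const _)

theorem differentiable_pv (hx : ContDiff ℝ 2 fun p : ℝ × ℝ => x p.1 p.2) :
    Differentiable ℝ fun p : ℝ × ℝ => pv x p.1 p.2 := by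
  have h : (fun p : ℝ × ℝ => pv x p.1 p.2) =
      fun p => fderiv ℝ (fun p : ℝ × ℝ => x p.1 p.2) p (0, 1) := by
    funext p
    exact ((hx.differentiable two_ne_zero p).hasFDerivAt.comp_hasDerivAt p.2
      ((hasDerivAt_const p.2 p.1).prodMk (hasDerivAt_id p.2))).deriv
  rw [h]
  exact ((hx.fderiv_right (m := 1) (by norm_num)).differentiable one_ne_zero).clm_apply
    (differentiable_const _)

end Partials

/-- Vectors with nonzero cross product are linearly independent. -/
theorem smul_add_smul_ne_zero_of_cross_ne_zero {U V : E3} (h : cross U V ≠ 0) {a b : ℝ}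
    (hab : (a, b) ≠ (0, 0)) : a • U + b • V ≠ 0 := by
  intro h0
  have hc : ∀ i, a * U i + b * V i = 0 := fun i => by
    simpa using congrArg (fun w : E3 => w i) h0
  have h0 := hc 0
  have h1 := hc 1
  have h2 := hc 2
  have ha : a • cross U V = 0 := by
    ext i
    fin_cases i <;> simp [cross] <;> grind
  have hb : b • cross U V = 0 := by
    ext i
    fin_cases i <;> simp [cross] <;> grind
  exact hab (Prod.ext ((smul_eq_zero.1 ha).resolve_right h) ((smul_eq_zero.1 hb).resolve_right h))

theorem asymptotic_vectors_invariant_iff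
    (c : E3) (r : ℝ) (hr : 0 < r)
    (x : ℝ → ℝ → E3)
    (hx : ContDiff ℝ (⊤ : ℕ∞) (fun p : ℝ × ℝ => x p.1 p.2))
    (hxc : ∀ u v : ℝ, x u v ≠ c)
    (y : ℝ → ℝ → E3) (hy : ∀ u v : ℝ, y u v = inv3 c r (x u v))
    (hreg : ∀ u v : ℝ, cross (pu x u v) (pv x u v) ≠ 0)
    (u₀ v₀ : ℝ) (a b : ℝ) (hab : (a, b) ≠ (0, 0))
    (hasym : SFe x u₀ v₀ * a ^ 2 + 2 * SFf x u₀ v₀ * a * b + SFg x u₀ v₀ * b ^ 2 = 0) :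
    (SFe y u₀ v₀ * a ^ 2 + 2 * SFf y u₀ v₀ * a * b + SFg y u₀ v₀ * b ^ 2 = 0) ↔
      eta c x u₀ v₀ = 0 := by
  have hx2 : ContDiff ℝ 2 fun p : ℝ × ℝ => x p.1 p.2 :=
    hx.of_le (WithTop.coe_le_coe.2 le_top)
  have hd := hx2.differentiable two_ne_zero
  have hdu := differentiable_pu hx2
  have hdv := differentiable_pv hx2
  obtain rfl : y = fun u v => inv3 c r (x u v) := by
    funext u v
    exact hy u v
  have hyu : pu (fun u v => inv3 c r (x u v)) = fun u v => phiStar c r (x u v) (pu x u v) := by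
    funext u v
    exact (hasDerivAt_inv3 c r (hasDerivAt_slice_left hd u v) (hxc u v)).deriv
  have hyv : pv (fun u v => inv3 c r (x u v)) = fun u v => phiStar c r (x u v) (pv x u v) := by
    funext u v
    exact (hasDerivAt_inv3 c r (hasDerivAt_slice_right hd u v) (hxc u v)).deriv
  have hyuu : pu (fun u v => phiStar c r (x u v) (pu x u v)) u₀ v₀ = _ :=
    (hasDerivAt_phiStar c r (hasDerivAt_slice_left hd u₀ v₀) (hasDerivAt_slice_left hdu u₀ v₀)
      (hxc u₀ v₀)).deriv
  have hyuv : pv (fun u v => phiStar c r (x u v) (pu x u v)) u₀ v₀ = _ :=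
    (hasDerivAt_phiStar c r (hasDerivAt_slice_right hd u₀ v₀) (hasDerivAt_slice_right hdu u₀ v₀)
      (hxc u₀ v₀)).deriv
  have hyvv : pv (fun u v => phiStar c r (x u v) (pv x u v)) u₀ v₀ = _ :=
    (hasDerivAt_phiStar c r (hasDerivAt_slice_right hd u₀ v₀) (hasDerivAt_slice_right hdv u₀ v₀)
      (hxc u₀ v₀)).deriv
  have hp := hxc u₀ v₀
  have hN := hreg u₀ v₀
  have hw := smul_add_smul_ne_zero_of_cross_ne_zero hN hab
  have hwpos := real_inner_self_pos.2 hw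
  have hcross := cross_phiStar c r (x u₀ v₀) (pu x u₀ v₀) (pv x u₀ v₀) hp
  have hnorm := norm_sq_cross_phiStar c r (x u₀ v₀) (pu x u₀ v₀) (pv x u₀ v₀) hp
  have hUN := inner_self_cross (pu x u₀ v₀) (pv x u₀ v₀)
  have hVN := inner_cross_self (pu x u₀ v₀) (pv x u₀ v₀)
  have hz : ‖x u₀ v₀ - c‖ ≠ 0 := norm_ne_zero_iff.2 (sub_ne_zero.2 hp)
  have hn : ‖cross (pu x u₀ v₀) (pv x u₀ v₀)‖ ≠ 0 := norm_ne_zero_iff.2 hN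
  have hm : ‖cross (phiStar c r (x u₀ v₀) (pu x u₀ v₀)) (phiStar c r (x u₀ v₀) (pv x u₀ v₀))‖
      ≠ 0 := by
    intro h0
    rw [h0] at hnorm
    have : (r ^ 2 / ‖x u₀ v₀ - c‖ ^ 2) ^ 4 * ‖cross (pu x u₀ v₀) (pv x u₀ v₀)‖ ^ 2 ≠ 0 := by
      positivity
    exact this (by simpa using hnorm.symm)
  simp only [SFe, SFf, SFg, eta, unormal, hyu, hyv, hyuu, hyuv, hyvv, inner_smul_right,
    inner_smul_left, conj_trivial] at hasym ⊢
  generalize ‖cross (phiStar c r (x u₀ v₀) (pu x u₀ v₀)) (phiStar c r (x u₀ v₀) (pv x u₀ v₀))‖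
    = k at hm ⊢
  rw [hcross]
  simp only [inner_smul_right, inner_phiStarDeriv c r _ _ _ _ _ hp hUN hUN,
    inner_phiStarDeriv c r _ _ _ _ _ hp hVN hUN, inner_phiStarDeriv c r _ _ _ _ _ hp hVN hVN]
  simp only [inner_add_left, inner_add_right, inner_smul_left, inner_smul_right, conj_trivial,
    real_inner_comm (pu x u₀ v₀) (pv x u₀ v₀)] at hwpos
  rw [real_inner_comm (x u₀ v₀ - c)]
  generalize x u₀ v₀ - c = z at *
  generalize cross (pu x u₀ v₀) (pv x u₀ v₀) = N at *
  rw [real_inner_comm (pu x u₀ v₀) (pv x u₀ v₀)]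
  have hscale : k⁻¹ * (r ^ 2 / ‖z‖ ^ 2) ^ 2 * (2 * r ^ 2 / ‖z‖ ^ 4) ≠ 0 := by positivity
  have hform := mul_ne_zero hscale hwpos.ne'
  rw [mul_eq_zero, or_iff_right (inv_ne_zero hn)]
  refine Iff.trans (Eq.congr_left ?_) (mul_eq_zero_iff_left (neg_ne_zero.2 hform))
  have hII : ⟪pu (pu x) u₀ v₀, N⟫ * a ^ 2 + 2 * ⟪pv (pu x) u₀ v₀, N⟫ * a * b
      + ⟪pv (pv x) u₀ v₀, N⟫ * b ^ 2 = 0 :=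
    (mul_eq_zero.1 (by linear_combination hasym)).resolve_left (inv_ne_zero hn)
  linear_combination (-k⁻¹ * (r ^ 2 / ‖z‖ ^ 2) ^ 3) * hII
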